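/- arXiv:1901.09335 — 3 statements merged into one kernel-verified Lean document; each statement's English description precedes it below -/
import Mathlib

section
/- The bound λ_max < 2/η in the convergence theorem is tight in the following sense. Suppose H_n = 0 for every index n not belonging to one distinguished batch 𝓑(k₀), so that λ_max is the largest eigenvalue of ⟨H⟩_{k₀}, and suppose λ_max > 2/η. Let w_0 be a unit eigenvector of ⟨H⟩_{k₀} with eigenvalue λ_max, let k(0), k(1), ... be i.i.d. uniform on {1,...,K}, and define w_{t+1} = (I − η⟨H⟩_{k(t)}) w_t. Then E‖w_t‖² = ( (K−1)/K + (1/K)(1 − ηλ_max)² )^t, which tends to infinity as t → ∞. -/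
open scoped RealInnerProductSpace

/-- If every linear map `T k` scales `w0` by `c k`, then a composition of such maps scales `w0` by the
product of the corresponding factors. -/
theorem iterate_eq_prod_smul {κ E : Type*} [AddCommGroup E] [Module ℝ E]
    (T : κ → E →ₗ[ℝ] E) (c : κ → ℝ) (w0 : E) (hT : ∀ k, T k w0 = c k • w0)
    (w : (t : ℕ) → (Fin t → κ) → E) (hw0 : ∀ ks : Fin 0 → κ, w 0 ks = w0)
    (hwrec : ∀ (t : ℕ) (ks : Fin (t + 1) → κ),
      w (t + 1) ks = T (ks (Fin.last t)) (w t (fun i => ks i.castSucc)))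
    (t : ℕ) (ks : Fin t → κ) : w t ks = (∏ i, c (ks i)) • w0 := by
  induction t with
  | zero => simp [hw0]
  | succ t ih =>
    rw [hwrec, ih, map_smul, hT, smul_smul, Fin.prod_univ_castSucc]

/-- Summing a function that takes the value `a` at one point and `1` at all others. -/
theorem sum_ite_eq_card_sub_one_add {κ : Type*} [Fintype κ] [DecidableEq κ] (k₀ : κ) (a : ℝ) :
    ∑ k, (if k = k₀ then a else 1) = ((Fintype.card κ : ℝ) - 1) + a := by
  have h (k : κ) : (if k = k₀ then a else 1) = 1 + (if k = k₀ then a - 1 else 0) := by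
    split_ifs <;> ring
  simp only [h, Finset.sum_add_distrib, Finset.sum_ite_eq', Finset.mem_univ, if_true,
    Finset.sum_const, Finset.card_univ, nsmul_eq_mul]
  ring

theorem sgd_divergence_above_critical_rate
    (d N B K : ℕ) (hd : 0 < d) (hB : 0 < B) (hK : 0 < K) (hN : N = K * B)
    (H : Fin N → Matrix (Fin d) (Fin d) ℝ) (hH : ∀ n, (H n).PosSemidef)
    (𝓑 : Fin K → Finset (Fin N))
    (hcard : ∀ k, (𝓑 k).card = B)
    (hdisj : ∀ k k' : Fin K, k ≠ k' → Disjoint (𝓑 k) (𝓑 k'))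
    (hcover : ∀ n : Fin N, ∃ k : Fin K, n ∈ 𝓑 k)
    (Hb : Fin K → Matrix (Fin d) (Fin d) ℝ)
    (hHb : ∀ k, Hb k = (B : ℝ)⁻¹ • ∑ n ∈ 𝓑 k, H n)
    (η : ℝ) (hη : 0 < η)
    (k₀ : Fin K)
    (hzero : ∀ n : Fin N, n ∉ 𝓑 k₀ → H n = 0)
    (lammax : ℝ)
    (hlammax : IsGreatest {r : ℝ | ∃ v : EuclideanSpace ℝ (Fin d),
        ‖v‖ = 1 ∧ r = ⟪v, Matrix.toEuclideanLin (Hb k₀) v⟫} lammax)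
    (hdiv : 2 / η < lammax)
    (w0 : EuclideanSpace ℝ (Fin d))
    (w : (t : ℕ) → (Fin t → Fin K) → EuclideanSpace ℝ (Fin d))
    (hw0 : ∀ ks : Fin 0 → Fin K, w 0 ks = w0)
    (hwrec : ∀ (t : ℕ) (ks : Fin (t + 1) → Fin K),
        w (t + 1) ks = Matrix.toEuclideanLin ((1 : Matrix (Fin d) (Fin d) ℝ) - η • Hb (ks (Fin.last t)))
          (w t (fun i => ks i.castSucc)))
    (hw0norm : ‖w0‖ = 1)
    (hw0eig : Matrix.toEuclideanLin (Hb k₀) w0 = lammax • w0) :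
    (∀ t : ℕ, (∑ ks : Fin t → Fin K, ‖w t ks‖ ^ 2) / (K : ℝ) ^ t
        = (((K : ℝ) - 1) / K + (1 / K) * (1 - η * lammax) ^ 2) ^ t) ∧
    Filter.Tendsto
      (fun t : ℕ => (((K : ℝ) - 1) / K + (1 / K) * (1 - η * lammax) ^ 2) ^ t)
      Filter.atTop Filter.atTop := by
  have hKpos : (0 : ℝ) < K := by exact_mod_cast hK
  have hHb_zero (k : Fin K) (hk : k ≠ k₀) : Hb k = 0 := by
    rw [hHb, Finset.sum_eq_zero, smul_zero]
    exact fun n hn => hzero n (Finset.disjoint_left.mp (hdisj k k₀ hk) hn)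
  have hscale (k : Fin K) :
      Matrix.toEuclideanLin ((1 : Matrix (Fin d) (Fin d) ℝ) - η • Hb k) w0
        = (if k = k₀ then 1 - η * lammax else 1) • w0 := by
    have hone : Matrix.toEuclideanLin (1 : Matrix (Fin d) (Fin d) ℝ) w0 = w0 := by
      simp
    rw [map_sub, map_smul, LinearMap.sub_apply, LinearMap.smul_apply, hone]
    split_ifs with hk
    · rw [hk, hw0eig, smul_smul, sub_smul, one_smul]
    · simp [hHb_zero k hk]
  have hnorm (t : ℕ) (ks : Fin t → Fin K) :
      ‖w t ks‖ ^ 2 = ∏ i, (if ks i = k₀ then (1 - η * lammax) ^ 2 else 1) := by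
    rw [iterate_eq_prod_smul _ _ w0 hscale w hw0 hwrec, norm_smul, hw0norm, mul_one,
      Real.norm_eq_abs, sq_abs, ← Finset.prod_pow]
    simp only [ite_pow, one_pow]
  refine ⟨fun t => ?_, tendsto_pow_atTop_atTop_of_one_lt ?_⟩
  · simp only [hnorm]
    rw [← Fintype.sum_pow (fun k => if k = k₀ then (1 - η * lammax) ^ 2 else (1 : ℝ)),
      sum_ite_eq_card_sub_one_add, Fintype.card_fin, ← div_pow]
    congr 1
    ring
  · have hlam : 2 < η * lammax := (div_lt_iff₀' hη).mp hdiv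
    have heq : ((K : ℝ) - 1) / K + (1 / K) * (1 - η * lammax) ^ 2
        = 1 + ((1 - η * lammax) ^ 2 - 1) / K := by
      field_simp
      ring
    rw [heq, lt_add_iff_pos_right]
    exact div_pos (by nlinarith) hKpos
end

section
/- Second-moment stability condition: if λ_max < 2/η, then for every unit vector v in the orthogonal complement of the null space of ⟨H⟩, vᵀ (I − 2η⟨H⟩ + η²⟨H²⟩) v < 1. -/
open scoped RealInnerProductSpace

/-- A positive operator `T` whose quadratic form is at most `c` satisfies
`t (2 - t c) ‖T v‖² ≤ ⟪v, T v⟫` for every real `t`. -/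
theorem LinearMap.IsPositive.mul_norm_apply_sq_le {E : Type*} [NormedAddCommGroup E]
    [InnerProductSpace ℝ E] {T : E →ₗ[ℝ] E} (hT : T.IsPositive) {c : ℝ}
    (hc : ∀ w, ⟪w, T w⟫ ≤ c * ‖w‖ ^ 2) (t : ℝ) (v : E) :
    t * (2 - t * c) * ‖T v‖ ^ 2 ≤ ⟪v, T v⟫ := by
  have hnonneg : 0 ≤ ⟪v - t • T v, T (v - t • T v)⟫ := hT.inner_nonneg_right _
  have hsymm : ⟪v, T (T v)⟫ = ‖T v‖ ^ 2 := by
    rw [← hT.isSymmetric, real_inner_self_eq_norm_sq]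
  simp only [map_sub, map_smul, inner_sub_left, inner_sub_right, real_inner_smul_left,
    real_inner_smul_right, hsymm, real_inner_self_eq_norm_sq] at hnonneg
  nlinarith [mul_le_mul_of_nonneg_left (hc (T v)) (sq_nonneg t)]

/-- A bound on a quadratic form over unit vectors extends to all vectors by homogeneity. -/
theorem LinearMap.inner_apply_le_mul_norm_sq {E : Type*} [NormedAddCommGroup E]
    [InnerProductSpace ℝ E] {T : E →ₗ[ℝ] E} {c : ℝ}
    (hc : ∀ w, ‖w‖ = 1 → ⟪w, T w⟫ ≤ c) (w : E) : ⟪w, T w⟫ ≤ c * ‖w‖ ^ 2 := by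
  rcases eq_or_ne w 0 with rfl | hw
  · simp
  have hpos : 0 < ‖w‖ := norm_pos_iff.mpr hw
  have h := hc (‖w‖⁻¹ • w) (by rw [norm_smul, norm_inv, norm_norm, inv_mul_cancel₀ hpos.ne'])
  rw [map_smul, real_inner_smul_left, real_inner_smul_right, ← mul_assoc, ← mul_inv,
    ← sq, inv_mul_le_iff₀ (by positivity)] at h
  linarith

/-- Averaging over the blocks of a partition into `K` blocks of size `B` gives the full average. -/
theorem smul_sum_eq_smul_sum_block {M : Type*} [AddCommGroup M] [Module ℝ M]
    {N B K : ℕ} (hN : N = K * B) (f : Fin N → M) (𝓑 : Fin K → Finset (Fin N))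
    (hdisj : ∀ k k' : Fin K, k ≠ k' → Disjoint (𝓑 k) (𝓑 k'))
    (hcover : ∀ n : Fin N, ∃ k : Fin K, n ∈ 𝓑 k) :
    (N : ℝ)⁻¹ • ∑ n, f n = (K : ℝ)⁻¹ • ∑ k, (B : ℝ)⁻¹ • ∑ n ∈ 𝓑 k, f n := by
  have huniv : (Finset.univ : Finset (Fin N)) = Finset.univ.biUnion 𝓑 := by
    ext n
    simpa using hcover n
  have hpair : ((Finset.univ : Finset (Fin K)) : Set (Fin K)).PairwiseDisjoint 𝓑 :=
    fun k _ k' _ h => hdisj k k' h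
  rw [huniv, Finset.sum_biUnion hpair, ← Finset.smul_sum, smul_smul, ← mul_inv,
    ← Nat.cast_mul, ← hN]

theorem one_sub_add_sq_lt_one {η c a b : ℝ} (hη : 0 < η) (hc : c * η < 2) (ha : 0 < a)
    (hb : 0 ≤ b) (hab : η / 2 * (2 - η / 2 * c) * b ≤ a) :
    1 - 2 * η * a + η ^ 2 * b < 1 := by
  have hlt : η * b < 2 * a := by
    rcases hb.eq_or_lt with rfl | hb
    · linarith
    · nlinarith [mul_pos (mul_pos hη hb) (sub_pos.mpr hc)]
  nlinarith [mul_lt_mul_of_pos_left hlt hη]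

theorem second_moment_stability_condition
    (d N B K : ℕ) (hd : 0 < d) (hB : 0 < B) (hK : 0 < K) (hN : N = K * B)
    (H : Fin N → Matrix (Fin d) (Fin d) ℝ) (hH : ∀ n, (H n).PosSemidef)
    (𝓑 : Fin K → Finset (Fin N))
    (hcard : ∀ k, (𝓑 k).card = B)
    (hdisj : ∀ k k' : Fin K, k ≠ k' → Disjoint (𝓑 k) (𝓑 k'))
    (hcover : ∀ n : Fin N, ∃ k : Fin K, n ∈ 𝓑 k)
    (Hb : Fin K → Matrix (Fin d) (Fin d) ℝ)
    (hHb : ∀ k, Hb k = (B : ℝ)⁻¹ • ∑ n ∈ 𝓑 k, H n)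
    (Havg : Matrix (Fin d) (Fin d) ℝ) (hHavg : Havg = (N : ℝ)⁻¹ • ∑ n, H n)
    (Hsq : Matrix (Fin d) (Fin d) ℝ) (hHsq : Hsq = (K : ℝ)⁻¹ • ∑ k, Hb k * Hb k)
    (η : ℝ) (hη : 0 < η)
    (lammax : ℝ)
    (hlammax : IsGreatest {r : ℝ | ∃ k : Fin K, ∃ v : EuclideanSpace ℝ (Fin d),
        ‖v‖ = 1 ∧ r = ⟪v, Matrix.toEuclideanLin (Hb k) v⟫} lammax)
    (hconv : lammax < 2 / η)
    (v : EuclideanSpace ℝ (Fin d))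
    (hv : ‖v‖ = 1)
    (hvmem : v ∈ (LinearMap.ker (Matrix.toEuclideanLin Havg))ᗮ) :
    ⟪v, Matrix.toEuclideanLin
        ((1 : Matrix (Fin d) (Fin d) ℝ) - (2 * η) • Havg + (η ^ 2) • Hsq) v⟫ < 1 := by
  set T : Fin K → EuclideanSpace ℝ (Fin d) →ₗ[ℝ] EuclideanSpace ℝ (Fin d) :=
    fun k => Matrix.toEuclideanLin (Hb k) with hTdef
  have hTpos (k : Fin K) : (T k).IsPositive := by
    refine Matrix.isPositive_toEuclideanLin_iff.mpr ?_
    rw [hHb k]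
    exact (Matrix.posSemidef_sum _ fun n _ => hH n).smul (by positivity)
  have hTle (k : Fin K) (w : EuclideanSpace ℝ (Fin d)) : ⟪w, T k w⟫ ≤ lammax * ‖w‖ ^ 2 :=
    LinearMap.inner_apply_le_mul_norm_sq (fun u hu => hlammax.2 ⟨k, u, hu, rfl⟩) w
  have hKpos : (0 : ℝ) < K := by exact_mod_cast hK
  have hηlam : lammax * η < 2 := (lt_div_iff₀ hη).mp hconv
  have havg : Matrix.toEuclideanLin Havg = (K : ℝ)⁻¹ • ∑ k, T k := by
    rw [hHavg, smul_sum_eq_smul_sum_block hN H 𝓑 hdisj hcover]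
    simp only [← hHb, map_smul, map_sum, hTdef]
  have havg_inner (w : EuclideanSpace ℝ (Fin d)) :
      ⟪w, Matrix.toEuclideanLin Havg w⟫ = (K : ℝ)⁻¹ * ∑ k, ⟪w, T k w⟫ := by
    simp [havg, real_inner_smul_right, inner_sum]
  have hsq_inner :
      ⟪v, Matrix.toEuclideanLin Hsq v⟫ = (K : ℝ)⁻¹ * ∑ k, ‖T k v‖ ^ 2 := by
    have hmul (k : Fin K) : Matrix.toEuclideanLin (Hb k * Hb k) v = T k (T k v) := by
      simp [hTdef, Matrix.toLpLin_apply, Matrix.mulVec_mulVec]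
    simp only [hHsq, map_smul, map_sum, LinearMap.smul_apply, LinearMap.sum_apply, hmul,
      real_inner_smul_right, inner_sum]
    congr! 2 with k
    rw [← (hTpos k).isSymmetric, real_inner_self_eq_norm_sq]
  have havg_pos : (Matrix.toEuclideanLin Havg).IsPositive := by
    refine Matrix.isPositive_toEuclideanLin_iff.mpr ?_
    rw [hHavg]
    exact (Matrix.posSemidef_sum _ fun n _ => hH n).smul (by positivity)
  have havg_le (w : EuclideanSpace ℝ (Fin d)) :
      ⟪w, Matrix.toEuclideanLin Havg w⟫ ≤ lammax * ‖w‖ ^ 2 := by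
    rw [havg_inner, inv_mul_le_iff₀ hKpos]
    simpa using Finset.sum_le_sum fun k (_ : k ∈ Finset.univ) => hTle k w
  have hcoef : 0 < η / 2 * (2 - η / 2 * lammax) := mul_pos (by positivity) (by linarith)
  have hinner_pos : 0 < ⟪v, Matrix.toEuclideanLin Havg v⟫ := by
    refine (havg_pos.inner_nonneg_right v).lt_of_ne' fun h0 => ?_
    have hbound := havg_pos.mul_norm_apply_sq_le havg_le (η / 2) v
    have hker : Matrix.toEuclideanLin Havg v = 0 := by
      by_contra hne
      have hnorm := norm_pos_iff.mpr hne
      have := mul_pos hcoef (pow_pos hnorm 2)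
      linarith
    have hself : ⟪v, v⟫ = 0 := hvmem v hker
    rw [real_inner_self_eq_norm_sq, hv] at hself
    norm_num at hself
  have hsq_le : η / 2 * (2 - η / 2 * lammax) * ⟪v, Matrix.toEuclideanLin Hsq v⟫ ≤
      ⟪v, Matrix.toEuclideanLin Havg v⟫ := by
    rw [hsq_inner, havg_inner, mul_left_comm, Finset.mul_sum]
    gcongr with k
    exact (hTpos k).mul_norm_apply_sq_le (hTle k) _ v
  have hsq_nonneg : 0 ≤ ⟪v, Matrix.toEuclideanLin Hsq v⟫ := by
    rw [hsq_inner]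
    exact mul_nonneg (inv_nonneg.mpr hKpos.le) (Finset.sum_nonneg fun _ _ => sq_nonneg _)
  have hexpand : ⟪v, Matrix.toEuclideanLin
      ((1 : Matrix (Fin d) (Fin d) ℝ) - (2 * η) • Havg + (η ^ 2) • Hsq) v⟫ =
      1 - 2 * η * ⟪v, Matrix.toEuclideanLin Havg v⟫ +
        η ^ 2 * ⟪v, Matrix.toEuclideanLin Hsq v⟫ := by
    have hone : Matrix.toEuclideanLin (1 : Matrix (Fin d) (Fin d) ℝ) v = v := by
      simp
    simp only [map_add, map_sub, map_smul, LinearMap.add_apply, LinearMap.sub_apply,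
      LinearMap.smul_apply, inner_add_right, inner_sub_right, real_inner_smul_right, hone,
      real_inner_self_eq_norm_sq, hv, one_pow]
  rw [hexpand]
  exact one_sub_add_sq_lt_one hη hηlam hinner_pos hsq_nonneg hsq_le
end

section
/- One-step contraction on the complement of the null space: suppose λ_max < 2/η and ⟨H⟩ ≠ 0, and let λ_min = min{ vᵀ⟨H⟩v : ‖v‖ = 1, v orthogonal to the null space of ⟨H⟩ } be the smallest nonzero eigenvalue of ⟨H⟩. Then for every vector w in the orthogonal complement of the null space of ⟨H⟩, if k is a uniformly random index on {1,...,K}, E_k ‖(I − η⟨H⟩_k) w‖² ≤ (1 − η(2 − ηλ_max)λ_min) ‖w‖², and the contraction factor satisfies 0 ≤ 1 − η(2 − ηλ_max)λ_min < 1. -/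
open scoped RealInnerProductSpace

namespace LinearMap.IsPositive

variable {E : Type*} [NormedAddCommGroup E] [InnerProductSpace ℝ E] {T : E →ₗ[ℝ] E}

/-- The Cauchy–Schwarz inequality for the semi-inner product of a positive operator. -/
theorem inner_map_sq_le (hT : T.IsPositive) (x y : E) :
    ⟪x, T y⟫ ^ 2 ≤ ⟪x, T x⟫ * ⟪y, T y⟫ := by
  have hsymm : ⟪y, T x⟫ = ⟪x, T y⟫ := by
    rw [← hT.isSymmetric y x, real_inner_comm]
  have h : ∀ t : ℝ, 0 ≤ ⟪x, T x⟫ * (t * t) + (2 * ⟪x, T y⟫) * t + ⟪y, T y⟫ := by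
    intro t
    have h0 := hT.inner_nonneg_right (t • x + y)
    simp only [map_add, map_smul, inner_add_left, inner_add_right, real_inner_smul_left,
      real_inner_smul_right, hsymm] at h0
    linarith
  have := discrim_le_zero h
  unfold discrim at this
  linarith

/-- A positive operator with quadratic form at most `c ‖v‖ ^ 2` satisfies `T ^ 2 ≤ c T`. -/
theorem norm_map_sq_le (hT : T.IsPositive) {c : ℝ} (hc : ∀ v, ⟪v, T v⟫ ≤ c * ‖v‖ ^ 2) (v : E) :
    ‖T v‖ ^ 2 ≤ c * ⟪v, T v⟫ := by
  by_cases hv : T v = 0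
  · simp [hv]
  have hpos : 0 < ‖T v‖ ^ 2 := by positivity
  have hcs := hT.inner_map_sq_le (T v) v
  rw [real_inner_self_eq_norm_sq] at hcs
  have h := mul_le_mul_of_nonneg_right (hc (T v)) (hT.inner_nonneg_right v)
  refine le_of_mul_le_mul_left ?_ hpos
  linarith

theorem map_eq_zero_of_inner_eq_zero (hT : T.IsPositive) {v : E} (hv : ⟪v, T v⟫ = 0) :
    T v = 0 := by
  have hcs := hT.inner_map_sq_le (T v) v
  rw [hv, mul_zero] at hcs
  exact inner_self_eq_zero.mp (pow_eq_zero_iff two_ne_zero |>.mp (le_antisymm hcs (sq_nonneg _)))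

/-- One gradient step for a positive operator bounded by `c`. -/
theorem norm_sub_smul_map_sq_le (hT : T.IsPositive) {c : ℝ} (hc : ∀ v, ⟪v, T v⟫ ≤ c * ‖v‖ ^ 2)
    (η : ℝ) (v : E) :
    ‖v - η • T v‖ ^ 2 ≤ ‖v‖ ^ 2 - η * (2 - η * c) * ⟪v, T v⟫ := by
  rw [norm_sub_sq_real, real_inner_smul_right, norm_smul, mul_pow, Real.norm_eq_abs, sq_abs]
  have := mul_le_mul_of_nonneg_left (hT.norm_map_sq_le hc v) (sq_nonneg η)
  linarith

end LinearMap.IsPositive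

/-- The quadratic form of `T` at `v` in terms of its value at the normalized vector. -/
theorem inner_map_eq_norm_sq_mul_normalized {E : Type*} [NormedAddCommGroup E]
    [InnerProductSpace ℝ E] (T : E →ₗ[ℝ] E) (v : E) :
    ⟪v, T v⟫ = ⟪‖v‖⁻¹ • v, T (‖v‖⁻¹ • v)⟫ * ‖v‖ ^ 2 := by
  by_cases hv : v = 0
  · simp [hv]
  have : ‖v‖ ≠ 0 := norm_ne_zero_iff.mpr hv
  rw [map_smul, real_inner_smul_left, real_inner_smul_right]
  field_simp

theorem one_step_contraction_on_complement
    (d N B K : ℕ) (hd : 0 < d) (hB : 0 < B) (hK : 0 < K) (hN : N = K * B)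
    (H : Fin N → Matrix (Fin d) (Fin d) ℝ) (hH : ∀ n, (H n).PosSemidef)
    (𝓑 : Fin K → Finset (Fin N))
    (hcard : ∀ k, (𝓑 k).card = B)
    (hdisj : ∀ k k' : Fin K, k ≠ k' → Disjoint (𝓑 k) (𝓑 k'))
    (hcover : ∀ n : Fin N, ∃ k : Fin K, n ∈ 𝓑 k)
    (Hb : Fin K → Matrix (Fin d) (Fin d) ℝ)
    (hHb : ∀ k, Hb k = (B : ℝ)⁻¹ • ∑ n ∈ 𝓑 k, H n)
    (Havg : Matrix (Fin d) (Fin d) ℝ) (hHavg : Havg = (N : ℝ)⁻¹ • ∑ n, H n)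
    (η : ℝ) (hη : 0 < η)
    (lammax : ℝ)
    (hlammax : IsGreatest {r : ℝ | ∃ k : Fin K, ∃ v : EuclideanSpace ℝ (Fin d),
        ‖v‖ = 1 ∧ r = ⟪v, Matrix.toEuclideanLin (Hb k) v⟫} lammax)
    (hconv : lammax < 2 / η)
    (hne : Havg ≠ 0)
    (lammin : ℝ)
    (hlammin : IsLeast {r : ℝ | ∃ v : EuclideanSpace ℝ (Fin d), ‖v‖ = 1 ∧
        v ∈ (LinearMap.ker (Matrix.toEuclideanLin Havg))ᗮ ∧
        r = ⟪v, Matrix.toEuclideanLin Havg v⟫} lammin) :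
    (∀ w ∈ (LinearMap.ker (Matrix.toEuclideanLin Havg))ᗮ,
        (K : ℝ)⁻¹ * ∑ k : Fin K,
            ‖Matrix.toEuclideanLin ((1 : Matrix (Fin d) (Fin d) ℝ) - η • Hb k) w‖ ^ 2
          ≤ (1 - η * (2 - η * lammax) * lammin) * ‖w‖ ^ 2) ∧
    0 ≤ 1 - η * (2 - η * lammax) * lammin ∧
    1 - η * (2 - η * lammax) * lammin < 1 := by
  have hsum : Havg = (K : ℝ)⁻¹ • ∑ k, Hb k := by
    have huniv : (Finset.univ : Finset (Fin N)) = Finset.univ.biUnion 𝓑 := by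
      ext n
      simpa using hcover n
    rw [hHavg, huniv, Finset.sum_biUnion fun k _ k' _ h => hdisj k k' h]
    simp only [hHb, ← Finset.smul_sum, smul_smul, hN]
    push_cast
    rw [mul_inv]
  have hbpos : ∀ k, (Matrix.toEuclideanLin (Hb k)).IsPositive := fun k => by
    rw [Matrix.isPositive_toEuclideanLin_iff, hHb]
    exact (Matrix.posSemidef_sum _ fun n _ => hH n).smul (by positivity)
  have hapos : (Matrix.toEuclideanLin Havg).IsPositive := by
    rw [Matrix.isPositive_toEuclideanLin_iff, hHavg]
    exact (Matrix.posSemidef_sum _ fun n _ => hH n).smul (by positivity)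
  have hinner : ∀ w : EuclideanSpace ℝ (Fin d), ⟪w, Matrix.toEuclideanLin Havg w⟫ =
      (K : ℝ)⁻¹ * ∑ k, ⟪w, Matrix.toEuclideanLin (Hb k) w⟫ := fun w => by
    rw [hsum, map_smul, map_sum, LinearMap.smul_apply, LinearMap.sum_apply,
      real_inner_smul_right, inner_sum]
  have hmax : ∀ k (v : EuclideanSpace ℝ (Fin d)),
      ⟪v, Matrix.toEuclideanLin (Hb k) v⟫ ≤ lammax * ‖v‖ ^ 2 := fun k v => by
    by_cases hv : v = 0
    · simp [hv]
    rw [inner_map_eq_norm_sq_mul_normalized]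
    exact mul_le_mul_of_nonneg_right
      (hlammax.2 ⟨k, _, norm_smul_inv_norm (𝕜 := ℝ) hv, rfl⟩) (sq_nonneg _)
  have hmin : ∀ w ∈ (LinearMap.ker (Matrix.toEuclideanLin Havg))ᗮ,
      lammin * ‖w‖ ^ 2 ≤ ⟪w, Matrix.toEuclideanLin Havg w⟫ := fun w hw => by
    by_cases hv : w = 0
    · simp [hv]
    rw [inner_map_eq_norm_sq_mul_normalized]
    exact mul_le_mul_of_nonneg_right (hlammin.2 ⟨_, norm_smul_inv_norm (𝕜 := ℝ) hv,
      Submodule.smul_mem _ _ hw, rfl⟩) (sq_nonneg _)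
  have hrate : 0 < η * (2 - η * lammax) := by
    rw [lt_div_iff₀ hη] at hconv
    exact mul_pos hη (by linarith)
  have hK' : (K : ℝ) ≠ 0 := by positivity
  have hstep : ∀ w ∈ (LinearMap.ker (Matrix.toEuclideanLin Havg))ᗮ,
      (K : ℝ)⁻¹ * ∑ k : Fin K,
          ‖Matrix.toEuclideanLin ((1 : Matrix (Fin d) (Fin d) ℝ) - η • Hb k) w‖ ^ 2
        ≤ (1 - η * (2 - η * lammax) * lammin) * ‖w‖ ^ 2 := by
    intro w hw
    have happ : ∀ k, Matrix.toEuclideanLin ((1 : Matrix (Fin d) (Fin d) ℝ) - η • Hb k) w =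
        w - η • Matrix.toEuclideanLin (Hb k) w := fun k => by
      rw [map_sub, map_smul, LinearMap.sub_apply, LinearMap.smul_apply, Matrix.toLpLin_one,
        LinearMap.id_apply]
    calc _ ≤ (K : ℝ)⁻¹ * ∑ k : Fin K, (‖w‖ ^ 2 - η * (2 - η * lammax) *
            ⟪w, Matrix.toEuclideanLin (Hb k) w⟫) := by
          gcongr with k
          rw [happ]
          exact (hbpos k).norm_sub_smul_map_sq_le (hmax k) η w
      _ = ‖w‖ ^ 2 - η * (2 - η * lammax) * ⟪w, Matrix.toEuclideanLin Havg w⟫ := by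
          rw [hinner, Finset.sum_sub_distrib, ← Finset.mul_sum, Finset.sum_const,
            Finset.card_univ, Fintype.card_fin, nsmul_eq_mul]
          field_simp
      _ ≤ _ := by
          have := mul_le_mul_of_nonneg_left (hmin w hw) hrate.le
          linarith
  obtain ⟨v, hv1, hvmem, hv⟩ := hlammin.1
  have hlampos : 0 < lammin := by
    rw [hv]
    refine (hapos.inner_nonneg_right v).lt_of_ne' fun h0 => ?_
    have hker : v ∈ LinearMap.ker (Matrix.toEuclideanLin Havg) :=
      hapos.map_eq_zero_of_inner_eq_zero h0
    have : v = 0 := inner_self_eq_zero.mp (hvmem v hker)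
    simp [this] at hv1
  refine ⟨hstep, ?_, ?_⟩
  · have h := hstep v hvmem
    rw [hv1, one_pow, mul_one] at h
    exact (mul_nonneg (inv_nonneg.mpr K.cast_nonneg)
      (Finset.sum_nonneg fun _ _ => sq_nonneg _)).trans h
  · linarith [mul_pos hrate hlampos]
end
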